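/- arXiv:1607.03046 — 2 statements merged into one kernel-verified Lean document; each statement's English description precedes it below -/
import Mathlib

section
/- For all 1 ≤ k ≤ n, the number of rooted labeled forests on [n] avoiding all three patterns 312, 213, and 132 and having exactly k trees equals (n!/k!)·C(n−1,k−1), where C(a,b) denotes the binomial coefficient. -/
/-- A rooted labeled forest on `[n]`, encoded as a parent function
`p : Fin n → Option (Fin n)` (`p v = none` means `v` is a root).
Acyclicity is expressed by the existence of a depth function strictly
decreasing from each vertex to its parent. -/
def IsForest {n : ℕ} (p : Fin n → Option (Fin n)) : Prop :=
  ∃ d : Fin n → ℕ, ∀ v w : Fin n, p v = some w → d w < d v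

/-- `StrictAnc p a b` means `a` is a strict ancestor of `b` in the forest `p`. -/
def StrictAnc {n : ℕ} (p : Fin n → Option (Fin n)) (a b : Fin n) : Prop :=
  Relation.TransGen (fun x y : Fin n => p y = some x) a b

/-- The forest `p` contains the pattern `σ` (given in one-line notation):
there is a chain of vertices along some root-to-vertex path whose labels
are order-isomorphic to `σ`. -/
def ForestContains {n : ℕ} (p : Fin n → Option (Fin n)) (σ : List ℕ) : Prop :=
  ∃ u : Fin σ.length → Fin n,
    (∀ i j : Fin σ.length, i < j → StrictAnc p (u i) (u j)) ∧
    (∀ i j : Fin σ.length, σ.get i < σ.get j ↔ u i < u j)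

/-- The forest `p` avoids the pattern `σ`. -/
def ForestAvoids {n : ℕ} (p : Fin n → Option (Fin n)) (σ : List ℕ) : Prop :=
  ¬ ForestContains p σ

/-- Number of cycles (including fixed points) in the cycle decomposition of a
permutation. -/
def permNumCycles {n : ℕ} (π : Equiv.Perm (Fin n)) : ℕ :=
  π.cycleType.card + (Finset.univ.filter fun x => π x = x).card

/-- Unsigned Stirling number of the first kind: the number of permutations of
`[n]` with exactly `k` cycles. -/
noncomputable def stirlingFirst (n k : ℕ) : ℕ :=
  Nat.card {π : Equiv.Perm (Fin n) // permNumCycles π = k}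

/-- Stirling number of the second kind: the number of partitions of `[n]`
into `k` nonempty subsets. -/
noncomputable def stirlingSecond (n k : ℕ) : ℕ :=
  Nat.card {P : Finpartition (Finset.univ : Finset (Fin n)) // P.parts.card = k}

/-- The Bell number: the number of set partitions of `[n]`. -/
noncomputable def bellNumber (n : ℕ) : ℕ :=
  Nat.card (Finpartition (Finset.univ : Finset (Fin n)))

/-- A vertex is a top-down maximum if it is larger than all of its ancestors. -/
def IsTopDownMax {n : ℕ} (p : Fin n → Option (Fin n)) (v : Fin n) : Prop :=
  ∀ u : Fin n, StrictAnc p u v → u < v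

lemma forestContains_triple_iff {n : ℕ} (p : Fin n → Option (Fin n)) (i j k : ℕ) :
    ForestContains p [i, j, k] ↔ ∃ a b c : Fin n, StrictAnc p a b ∧ StrictAnc p b c ∧
      (i < j ↔ a < b) ∧ (j < i ↔ b < a) ∧ (i < k ↔ a < c) ∧ (k < i ↔ c < a) ∧
      (j < k ↔ b < c) ∧ (k < j ↔ c < b) := by
  constructor
  · rintro ⟨u, hanc, hord⟩
    exact ⟨u (0 : Fin 3), u (1 : Fin 3), u (2 : Fin 3),
      hanc (0 : Fin 3) (1 : Fin 3) Nat.zero_lt_one,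
      hanc (1 : Fin 3) (2 : Fin 3) Nat.one_lt_two,
      hord (0 : Fin 3) (1 : Fin 3), hord (1 : Fin 3) (0 : Fin 3), hord (0 : Fin 3) (2 : Fin 3),
      hord (2 : Fin 3) (0 : Fin 3), hord (1 : Fin 3) (2 : Fin 3), hord (2 : Fin 3) (1 : Fin 3)⟩
  · rintro ⟨a, b, c, hab, hbc, h1, h2, h3, h4, h5, h6⟩
    have hac : StrictAnc p a c := Relation.TransGen.trans hab hbc
    refine ⟨(![a, b, c] : Fin 3 → Fin n), ?_, ?_⟩
    · change ∀ x y : Fin 3, x < y → StrictAnc p (![a, b, c] x) (![a, b, c] y)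
      intro x y hxy
      fin_cases x <;> fin_cases y <;> first | exact absurd hxy (by decide) | assumption
    · change ∀ x y : Fin 3, [i, j, k].get x < [i, j, k].get y ↔ ![a, b, c] x < ![a, b, c] y
      intro x y
      fin_cases x <;> fin_cases y <;>
        first | assumption | exact iff_of_false (lt_irrefl _) (lt_irrefl _)

/-- The rank of `v` in the linear order on labels along which every path starting at a root
labeled `r` of an avoiding forest increases: first the labels `≥ r` in increasing order,
then the labels `< r` in decreasing order. -/
def rootKey {n : ℕ} (r v : Fin n) : ℕ := if r ≤ v then v else 2 * n - v

lemma rootKey_injective {n : ℕ} (r : Fin n) : Function.Injective (rootKey r) := by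
  intro v w h
  unfold rootKey at h
  ext
  split_ifs at h <;> omega

lemma rootKey_self_lt {n : ℕ} {r v : Fin n} (h : v ≠ r) : rootKey r r < rootKey r v := by
  have : (v : ℕ) ≠ r := fun h' => h (Fin.ext h')
  unfold rootKey
  simp only [Fin.le_def]
  split_ifs <;> omega

/-- `c` sends every vertex to the root of its tree, and every vertex of the tree of `r` comes
after its parent in the order given by `rootKey r`. -/
def IsRootMap {n : ℕ} (c : Fin n → Fin n) (p : Fin n → Option (Fin n)) : Prop :=
  ∀ v, (p v = none → c v = v) ∧
    ∀ w, p v = some w → c w = c v ∧ rootKey (c v) w < rootKey (c v) v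

namespace IsRootMap

variable {n : ℕ} {c : Fin n → Fin n} {p : Fin n → Option (Fin n)}

lemma isForest (h : IsRootMap c p) : IsForest p := by
  refine ⟨fun v => rootKey (c v) v, fun v w hvw => ?_⟩
  obtain ⟨h1, h2⟩ := (h v).2 w hvw
  simpa only [h1] using h2

lemma of_strictAnc (h : IsRootMap c p) {a b : Fin n} (hab : StrictAnc p a b) :
    c a = c b ∧ rootKey (c a) a < rootKey (c a) b := by
  induction hab with
  | single hb =>
    obtain ⟨h1, h2⟩ := (h _).2 _ hb
    exact ⟨h1, h1 ▸ h2⟩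
  | tail _ hb ih =>
    obtain ⟨h1, h2⟩ := (h _).2 _ hb
    exact ⟨ih.1.trans h1, ih.2.trans (by rw [ih.1, h1]; exact h2)⟩

lemma avoids (h : IsRootMap c p) :
    ForestAvoids p [3, 1, 2] ∧ ForestAvoids p [2, 1, 3] ∧ ForestAvoids p [1, 3, 2] := by
  simp only [ForestAvoids, forestContains_triple_iff]
  refine ⟨?_, ?_, ?_⟩ <;>
  · rintro ⟨x, y, z, hxy, hyz, h1, h2, h3, h4, h5, h6⟩
    obtain ⟨hc, hk⟩ := h.of_strictAnc hxy
    obtain ⟨-, hk'⟩ := h.of_strictAnc hyz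
    rw [← hc] at hk'
    rw [Fin.lt_def] at h1 h2 h3 h4 h5 h6
    simp only [rootKey, Fin.le_def] at hk hk'
    split_ifs at hk hk' <;> omega

/-- The vertices fixed by the root map are exactly the roots. -/
lemma eq_self_iff (h : IsRootMap c p) (v : Fin n) : c v = v ↔ p v = none := by
  refine ⟨fun hv => ?_, (h v).1⟩
  rcases hp : p v with _ | w
  · rfl
  · obtain ⟨-, h2⟩ := (h v).2 w hp
    rw [hv] at h2
    by_cases hw : w = v
    · simp [hw] at h2
    · exact absurd (rootKey_self_lt hw) (by omega)

end IsRootMap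

lemma IsForest.existsUnique_root {n : ℕ} {p : Fin n → Option (Fin n)} (h : IsForest p)
    (v : Fin n) :
    ∃! r, Relation.ReflTransGen (fun x y : Fin n => p y = some x) r v ∧ p r = none := by
  obtain ⟨d, hd⟩ := h
  induction hm : d v using Nat.strong_induction_on generalizing v with
  | _ m ih =>
    rcases hp : p v with _ | w
    · refine ⟨v, ⟨.refl, hp⟩, ?_⟩
      rintro r ⟨hr, -⟩
      rcases Relation.ReflTransGen.cases_tail hr with h | ⟨y, -, hy⟩
      · exact h.symm
      · simp [hp] at hy
    · obtain ⟨r, ⟨hr, hr0⟩, huniq⟩ := ih (d w) (hm ▸ hd v w hp) w rfl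
      refine ⟨r, ⟨hr.tail hp, hr0⟩, ?_⟩
      rintro s ⟨hs, hs0⟩
      rcases Relation.ReflTransGen.cases_tail hs with h | ⟨y, hsy, hy⟩
      · subst h
        simp [hp] at hs0
      · obtain rfl : w = y := by simpa [hp] using hy
        exact huniq s ⟨hsy, hs0⟩

lemma depth_lt_of_strictAnc {n : ℕ} {p : Fin n → Option (Fin n)} {d : Fin n → ℕ}
    (hd : ∀ v w : Fin n, p v = some w → d w < d v) {a b : Fin n} (hab : StrictAnc p a b) :
    d a < d b := by
  induction hab with
  | single hb => exact hd _ _ hb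
  | tail _ hb ih => exact ih.trans (hd _ _ hb)

lemma exists_isRootMap {n : ℕ} {p : Fin n → Option (Fin n)} (hp : IsForest p)
    (h312 : ForestAvoids p [3, 1, 2]) (h213 : ForestAvoids p [2, 1, 3])
    (h132 : ForestAvoids p [1, 3, 2]) : ∃ c, IsRootMap c p := by
  choose c hc huniq using hp.existsUnique_root
  obtain ⟨d, hd⟩ := hp
  refine ⟨c, fun v => ⟨fun hv => (huniq v v ⟨.refl, hv⟩).symm, fun w hw => ?_⟩⟩
  have hcw : c w = c v := huniq v (c w) ⟨(hc w).1.tail hw, (hc w).2⟩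
  refine ⟨hcw, ?_⟩
  have hanc := (hc w).1
  rw [hcw] at hanc
  have hwv : StrictAnc p w v := .single hw
  have hne {a b : Fin n} (hab : StrictAnc p a b) : (a : ℕ) ≠ b := fun h => by
    have := depth_lt_of_strictAnc hd hab
    rw [Fin.ext h] at this
    exact lt_irrefl _ this
  rcases Relation.reflTransGen_iff_eq_or_transGen.1 hanc with h | h
  · rw [← h]
    exact rootKey_self_lt fun h' => hne hwv (by rw [h'])
  · have h1 := hne h
    have h2 := hne hwv
    have h3 := hne (h.trans hwv)
    simp only [ForestAvoids, forestContains_triple_iff, not_exists, not_and] at h312 h213 h132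
    have q1 := h312 _ _ _ h hwv
    have q2 := h213 _ _ _ h hwv
    have q3 := h132 _ _ _ h hwv
    simp only [Fin.lt_def, ← not_and] at q1 q2 q3
    simp only [rootKey, Fin.le_def]
    split_ifs <;> omega

lemma IsRootMap.unique {n : ℕ} {c c' : Fin n → Fin n} {p : Fin n → Option (Fin n)}
    (h : IsRootMap c p) (h' : IsRootMap c' p) : c = c' := by
  obtain ⟨d, hd⟩ := h.isForest
  funext v
  induction hm : d v using Nat.strong_induction_on generalizing v with
  | _ m ih =>
    rcases hp : p v with _ | w
    · rw [(h v).1 hp, (h' v).1 hp]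
    · rw [← ((h v).2 w hp).1, ← ((h' v).2 w hp).1]
      exact ih (d w) (hm ▸ hd v w hp) w rfl

lemma IsRootMap.root_eq_none {n : ℕ} {c : Fin n → Fin n} {p : Fin n → Option (Fin n)}
    (h : IsRootMap c p) (v : Fin n) : p (c v) = none := by
  obtain ⟨d, hd⟩ := h.isForest
  induction hm : d v using Nat.strong_induction_on generalizing v with
  | _ m ih =>
    rcases hp : p v with _ | w
    · rw [(h v).1 hp, hp]
    · rw [← ((h v).2 w hp).1]
      exact ih (d w) (hm ▸ hd v w hp) w rfl

lemma prod_one_add_card_lt {α : Type*} [DecidableEq α] (s : Finset α) (f : α → ℕ)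
    (hf : Function.Injective f) :
    ∏ v ∈ s, (1 + (s.filter fun w => f w < f v).card) = s.card.factorial := by
  induction s using Finset.induction_on_max_value f with
  | empty => simp
  | insert a s ha hmax ih =>
    have hlt (x) (hx : x ∈ s) : f x < f a :=
      lt_of_le_of_ne (hmax x hx) fun h => ha (hf h ▸ hx)
    rw [Finset.prod_insert ha, Finset.card_insert_of_notMem ha, Nat.factorial_succ, ← ih]
    congr 1
    · rw [Finset.filter_insert, if_neg (lt_irrefl _), Finset.filter_true_of_mem hlt, add_comm]
    · refine Finset.prod_congr rfl fun x hx => ?_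
      rw [Finset.filter_insert, if_neg (hlt x hx).not_gt]

lemma sum_prod_factorial_card_fiber (N R : Type*) [Fintype N] [Fintype R] [DecidableEq N]
    [DecidableEq R] :
    ∑ c : N → R, ∏ r, (Finset.univ.filter fun x => c x = r).card.factorial =
      (Fintype.card R).ascFactorial (Fintype.card N) := by
  have key (m : ℕ) : ∑ c : Fin m → R, ∏ r, (Finset.univ.filter fun x => c x = r).card.factorial =
      (Fintype.card R).ascFactorial m := by
    induction m with
    | zero => simp
    | succ m ih =>
      rw [← (Fin.consEquiv fun _ => R).sum_comp, Fintype.sum_prod_type, Finset.sum_comm,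
        Nat.ascFactorial_succ, ← ih, Finset.mul_sum]
      refine Finset.sum_congr rfl fun c _ => ?_
      have hcard (a r : R) : (Finset.univ.filter fun x : Fin (m + 1) =>
          Fin.consEquiv (fun _ => R) (a, c) x = r).card =
          (if a = r then 1 else 0) + (Finset.univ.filter fun x => c x = r).card := by
        rw [Fin.card_filter_univ_succ]
        change (if a = r then (Finset.univ.filter fun x => c x = r).card + 1 else
          (Finset.univ.filter fun x => c x = r).card) = _
        split_ifs <;> simp [add_comm]
      have hprod (a : R) : ∏ r, ((if a = r then 1 else 0) +
          (Finset.univ.filter fun x => c x = r).card).factorial =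
          (1 + (Finset.univ.filter fun x => c x = a).card) *
            ∏ r, (Finset.univ.filter fun x => c x = r).card.factorial := by
        rw [← Finset.mul_prod_erase _ _ (Finset.mem_univ a),
          ← Finset.mul_prod_erase Finset.univ (fun r => (Finset.card _).factorial)
            (Finset.mem_univ a), ← mul_assoc]
        congr 1
        · rw [if_pos rfl, add_comm 1, Nat.factorial_succ]
        · refine Finset.prod_congr rfl fun r hr => ?_
          rw [if_neg (Finset.ne_of_mem_erase hr).symm, zero_add]
      simp only [hcard, hprod]
      rw [← Finset.sum_mul, Finset.sum_add_distrib,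
        ← Finset.card_eq_sum_card_fiberwise (fun x _ => Finset.mem_univ (c x))]
      simp
  rw [← key, ← (Equiv.arrowCongr (Fintype.equivFin N) (Equiv.refl R)).sum_comp]
  refine Finset.sum_congr rfl fun c _ => Finset.prod_congr rfl fun r _ => ?_
  congr 1
  refine Finset.card_bij (fun x _ => Fintype.equivFin N x) ?_ ?_ ?_
  · simp
  · simp
  · intro y hy
    exact ⟨(Fintype.equivFin N).symm y, by simpa using hy, by simp⟩

/-- The map fixing `R` pointwise and equal to `c` outside of `R`. -/
def extendRoots {n : ℕ} {R : Finset (Fin n)} (c : {v // v ∉ R} → {v // v ∈ R}) (v : Fin n) :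
    Fin n :=
  if h : v ∈ R then v else c ⟨v, h⟩

lemma extendRoots_of_mem {n : ℕ} {R : Finset (Fin n)} (c : {v // v ∉ R} → {v // v ∈ R})
    {v : Fin n} (h : v ∈ R) : extendRoots c v = v := dif_pos h

lemma extendRoots_coe {n : ℕ} {R : Finset (Fin n)} (c : {v // v ∉ R} → {v // v ∈ R})
    (v : {v // v ∉ R}) : extendRoots c v = c v := dif_neg v.2

lemma extendRoots_eq_self_iff {n : ℕ} {R : Finset (Fin n)} (c : {v // v ∉ R} → {v // v ∈ R})
    (v : Fin n) : extendRoots c v = v ↔ v ∈ R := by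
  refine ⟨fun h => ?_, extendRoots_of_mem c⟩
  by_contra hv
  rw [extendRoots_coe c ⟨v, hv⟩] at h
  exact hv (h ▸ (c ⟨v, hv⟩).2)

lemma extendRoots_injective {n : ℕ} {R : Finset (Fin n)} :
    Function.Injective (extendRoots : ({v // v ∉ R} → {v // v ∈ R}) → Fin n → Fin n) := by
  intro c c' h
  funext v
  ext1
  rw [← extendRoots_coe, ← extendRoots_coe, h]

lemma card_isRootMap_extendRoots {n : ℕ} {R : Finset (Fin n)} (c : {v // v ∉ R} → {v // v ∈ R}) :
    Nat.card {p : Fin n → Option (Fin n) // IsRootMap (extendRoots c) p} =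
      ∏ r, (Finset.univ.filter fun x => c x = r).card.factorial := by
  classical
  let P (v : Fin n) (o : Option (Fin n)) : Prop := (o = none → extendRoots c v = v) ∧
    ∀ w, o = some w → extendRoots c w = extendRoots c v ∧
      rootKey (extendRoots c v) w < rootKey (extendRoots c v) v
  have hmem (v : {v // v ∈ R}) : (Finset.univ.filter (P v)).card = 1 := by
    rw [Finset.card_eq_one]
    refine ⟨none, ?_⟩
    ext (_ | w)
    · simp [P, extendRoots_of_mem c v.2]
    · simp only [Finset.mem_filter_univ, P, extendRoots_of_mem c v.2, Finset.mem_singleton,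
        reduceCtorEq, false_imp_iff, true_and, Option.some.injEq, forall_eq', iff_false, not_and,
        not_lt]
      intro _
      by_cases h : w = v
      · rw [h]
      · exact (rootKey_self_lt h).le
  have hnotMem (v : {v // v ∉ R}) : (Finset.univ.filter (P v)).card =
      1 + ((Finset.univ.filter fun x => c x = c v).filter fun x : {v // v ∉ R} =>
        rootKey (c v : Fin n) x < rootKey (c v : Fin n) v).card := by
    have hne : (c v : Fin n) ≠ v := fun h => v.2 (h ▸ (c v).2)
    have : Finset.univ.filter (P v) = insert (some (c v : Fin n))
        (((Finset.univ.filter fun x => c x = c v).filter fun x : {v // v ∉ R} =>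
          rootKey (c v : Fin n) x < rootKey (c v : Fin n) v).image
            fun x : {v // v ∉ R} => some (x : Fin n)) := by
      ext (_ | w)
      · simp [P, extendRoots_coe, hne]
      · by_cases hw : w ∈ R
        · simp only [Finset.mem_filter, Finset.mem_univ, P, extendRoots_coe,
            extendRoots_of_mem c hw, reduceCtorEq, false_imp_iff, true_and, Option.some.injEq, forall_eq',
            Finset.mem_insert, Finset.mem_image]
          constructor
          · exact fun h => .inl h.1
          · rintro (rfl | ⟨x, -, rfl⟩)
            · exact ⟨rfl, rootKey_self_lt hne.symm⟩
            · exact absurd hw x.2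
        · have hwc : w ≠ c v := fun h => hw (h ▸ (c v).2)
          have hw' : extendRoots c w = c ⟨w, hw⟩ := extendRoots_coe c ⟨w, hw⟩
          simp only [Finset.mem_filter, Finset.mem_univ, P, extendRoots_coe, hw', reduceCtorEq,
            false_imp_iff, true_and, Option.some.injEq, forall_eq', Finset.mem_insert,
            Finset.mem_image, hwc, false_or]
          constructor
          · exact fun h => ⟨⟨w, hw⟩, ⟨Subtype.ext h.1, h.2⟩, rfl⟩
          · rintro ⟨x, ⟨hx, hlt⟩, rfl⟩
            exact ⟨congrArg Subtype.val hx, hlt⟩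
    rw [this, Finset.card_insert_of_notMem, Finset.card_image_of_injective, add_comm]
    · exact fun x y h => Subtype.ext (Option.some.inj h)
    · simp only [Finset.mem_image, Option.some.injEq, not_exists, not_and]
      exact fun x _ h => x.2 (h ▸ (c v).2)
  calc Nat.card {p : Fin n → Option (Fin n) // IsRootMap (extendRoots c) p}
      = ∏ v, (Finset.univ.filter (P v)).card := by
        rw [← Fintype.card_piFinset, Nat.card_eq_fintype_card, Fintype.card_subtype]
        congr 1
        ext p
        rw [Finset.mem_filter_univ, Fintype.mem_piFinset]
        simp only [IsRootMap, P, Finset.mem_filter_univ]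
    _ = ∏ v : {v // v ∉ R}, (Finset.univ.filter (P v)).card := by
        rw [← Fintype.prod_subtype_mul_prod_subtype (· ∈ R), Finset.prod_eq_one fun v _ => hmem v,
          one_mul]
    _ = ∏ r, ∏ v with c v = r, (Finset.univ.filter (P v)).card :=
        (Finset.prod_fiberwise _ _ _).symm
    _ = _ := by
        refine Finset.prod_congr rfl fun r _ => ?_
        rw [← prod_one_add_card_lt _ (fun x : {v // v ∉ R} => rootKey (r : Fin n) x)
          ((rootKey_injective _).comp Subtype.val_injective)]
        refine Finset.prod_congr rfl fun v hv => ?_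
        obtain rfl : c v = r := by simpa using hv
        exact hnotMem v

lemma card_exists_isRootMap (n k : ℕ) :
    Nat.card {p : Fin n → Option (Fin n) //
        (∃ c, IsRootMap c p) ∧ Nat.card {v : Fin n // p v = none} = k} =
      n.choose k * k.ascFactorial (n - k) := by
  classical
  let Φ (x : Σ R : {R : Finset (Fin n) // R.card = k},
      Σ c : {v // v ∉ R.1} → {v // v ∈ R.1}, {p // IsRootMap (extendRoots c) p}) :
      {p : Fin n → Option (Fin n) //
        (∃ c, IsRootMap c p) ∧ Nat.card {v : Fin n // p v = none} = k} :=
    ⟨x.2.2.1, ⟨_, x.2.2.2⟩, by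
      simp only [← x.2.2.2.eq_self_iff, extendRoots_eq_self_iff]
      simpa using x.1.2⟩
  have hΦ : Function.Bijective Φ := by
    constructor
    · rintro ⟨⟨R, hR⟩, c, p, hp⟩ ⟨⟨R', hR'⟩, c', p', hp'⟩ h
      obtain rfl : p = p' := congrArg Subtype.val h
      have hc := hp.unique hp'
      obtain rfl : R = R' := by
        ext v
        rw [← extendRoots_eq_self_iff c, ← extendRoots_eq_self_iff c', hc]
      obtain rfl := extendRoots_injective hc
      rfl
    · rintro ⟨p, ⟨c, hc⟩, hk⟩
      let R : Finset (Fin n) := Finset.univ.filter fun v => p v = none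
      let c' (v : {v // v ∉ R}) : {v // v ∈ R} := ⟨c v, by simpa [R] using hc.root_eq_none v⟩
      have hext : extendRoots c' = c := by
        funext v
        by_cases hv : v ∈ R
        · rw [extendRoots_of_mem c' hv, (hc v).1 (by simpa [R] using hv)]
        · exact extendRoots_coe c' ⟨v, hv⟩
      refine ⟨⟨⟨R, ?_⟩, c', p, hext ▸ hc⟩, rfl⟩
      rw [← hk, Nat.card_eq_fintype_card, Fintype.card_subtype]
  rw [← Nat.card_congr (Equiv.ofBijective Φ hΦ), Nat.card_sigma]
  have hsum (R : {R : Finset (Fin n) // R.card = k}) :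
      Nat.card (Σ c : {v // v ∉ R.1} → {v // v ∈ R.1}, {p // IsRootMap (extendRoots c) p}) =
        k.ascFactorial (n - k) := by
    rw [Nat.card_sigma]
    simp only [card_isRootMap_extendRoots]
    rw [sum_prod_factorial_card_fiber, Fintype.card_subtype_compl]
    simp [R.2]
  simp only [hsum, Finset.sum_const, Finset.card_univ, smul_eq_mul]
  congr 1
  simp

lemma choose_mul_ascFactorial {n k : ℕ} (hk : 1 ≤ k) (hkn : k ≤ n) :
    n.choose k * k.ascFactorial (n - k) =
      (n.factorial / k.factorial) * (n - 1).choose (k - 1) := by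
  obtain ⟨q, hq⟩ := Nat.factorial_dvd_factorial hkn
  rw [hq, Nat.mul_div_cancel_left _ k.factorial_pos]
  obtain ⟨j, rfl⟩ := Nat.exists_eq_add_of_le' hk
  obtain ⟨m, rfl⟩ := Nat.exists_eq_add_of_le' (hk.trans hkn)
  have h1 := Nat.choose_mul_factorial_mul_factorial hkn
  have h2 := Nat.choose_mul_factorial_mul_factorial (show j ≤ m by omega)
  have h3 := Nat.factorial_mul_ascFactorial j (m - j)
  rw [Nat.add_sub_cancel' (show j ≤ m by omega)] at h3
  simp only [Nat.add_sub_add_right, Nat.add_sub_cancel] at *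
  have hpos : 0 < (j + 1).factorial * j.factorial * (m - j).factorial := by positivity
  refine Nat.eq_of_mul_eq_mul_left hpos ?_
  calc _ = (m + 1).choose (j + 1) * (j + 1).factorial * (m - j).factorial *
        (j.factorial * (j + 1).ascFactorial (m - j)) := by ring
    _ = (j + 1).factorial * q * (m.choose j * j.factorial * (m - j).factorial) := by
        rw [h1, h2, h3, hq]
    _ = _ := by ring

theorem count_forests_avoiding_312_213_132_by_trees (n k : ℕ) (hk : 1 ≤ k) (hkn : k ≤ n) :
    Nat.card {p : Fin n → Option (Fin n) //
        IsForest p ∧ ForestAvoids p [3, 1, 2] ∧ ForestAvoids p [2, 1, 3] ∧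
        ForestAvoids p [1, 3, 2] ∧ Nat.card {v : Fin n // p v = none} = k} =
    (n.factorial / k.factorial) * (n - 1).choose (k - 1) := by
  rw [← choose_mul_ascFactorial hk hkn, ← card_exists_isRootMap]
  refine Nat.card_congr (Equiv.subtypeEquivRight fun p => ⟨?_, ?_⟩)
  · rintro ⟨hp, h312, h213, h132, hroots⟩
    exact ⟨exists_isRootMap hp h312 h213 h132, hroots⟩
  · rintro ⟨⟨c, hc⟩, hroots⟩
    exact ⟨hc.isForest, hc.avoids.1, hc.avoids.2.1, hc.avoids.2.2, hroots⟩
end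

section
/- For all n ≥ 1, the number of rooted labeled forests on [n] avoiding all three patterns 132, 231, and 312 equals ∑_{k=1}^{n} (n!/k!)·C(n−1,k−1), where C(a,b) denotes the binomial coefficient. -/
open Finset in
/-- The numbers `ℓ n = ∑ k, C(n-1, k-1) / k!`, with `ℓ 0 = 1`. -/
def lahRatio : ℕ → ℚ
  | 0 => 1
  | n + 1 => ∑ k ∈ range (n + 1), (n.choose k : ℚ) / (k + 1).factorial

open Finset in
theorem sum_range_lahRatio (n : ℕ) :
    ∑ j ∈ range (n + 1), lahRatio j = ∑ k ∈ range (n + 1), (n.choose k : ℚ) / k.factorial := by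
  induction n with
  | zero => simp [lahRatio]
  | succ n ih =>
    rw [sum_range_succ, ih, sum_range_succ' _ (n + 1)]
    simp only [Nat.choose_succ_succ, Nat.cast_add, add_div, sum_add_distrib, lahRatio]
    have h : ∑ k ∈ range (n + 1), (n.choose k : ℚ) / k.factorial =
        ∑ k ∈ range (n + 1), (n.choose (k + 1) : ℚ) / (k + 1).factorial + 1 := by
      have h' := sum_range_succ (fun k => (n.choose k : ℚ) / k.factorial) (n + 1)
      rw [sum_range_succ'] at h'
      simpa using h'.symm
    rw [h]
    simp
    ring

open Finset in
theorem succ_mul_lahRatio_succ (n : ℕ) :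
    (n + 1 : ℚ) * lahRatio (n + 1) =
      ∑ k ∈ range (n + 1), ((n + 1).choose (k + 1) : ℚ) / k.factorial := by
  rw [lahRatio, mul_sum]
  refine sum_congr rfl fun k _ => ?_
  have h : ((n + 1 : ℕ) : ℚ) * n.choose k = (n + 1).choose (k + 1) * (k + 1 : ℕ) := by
    exact_mod_cast Nat.add_one_mul_choose_eq n k
  have hk : (k.factorial : ℚ) ≠ 0 := by positivity
  rw [Nat.factorial_succ]
  push_cast at h ⊢
  field_simp
  linarith

open Finset in
theorem lahRatio_recurrence (n : ℕ) :
    (n + 1 : ℚ) * lahRatio (n + 1) = n * lahRatio n + ∑ j ∈ range (n + 1), lahRatio j := by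
  cases n with
  | zero => simp [lahRatio]
  | succ n =>
    rw [succ_mul_lahRatio_succ, sum_range_lahRatio]
    push_cast
    rw [succ_mul_lahRatio_succ]
    simp only [Nat.choose_succ_succ (n + 1), Nat.cast_add, add_div, sum_add_distrib]
    rw [sum_range_succ (fun k => ((n + 1).choose (k + 1) : ℚ) / k.factorial) (n + 1)]
    simp
    ring

open Finset in
theorem cast_sum_eq_factorial_mul_lahRatio (n : ℕ) (hn : 1 ≤ n) :
    ((∑ k ∈ Icc 1 n, (n.factorial / k.factorial) * (n - 1).choose (k - 1) : ℕ) : ℚ) =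
      n.factorial * lahRatio n := by
  obtain ⟨m, rfl⟩ := Nat.exists_eq_add_of_le' hn
  rw [lahRatio, mul_sum, ← Finset.Ico_add_one_right_eq_Icc, sum_Ico_eq_sum_range, Nat.cast_sum]
  refine sum_congr rfl fun k hk => ?_
  have hk' : 1 + k ≤ m + 1 := by have := mem_range.1 hk; omega
  rw [Nat.cast_mul, Nat.cast_div (Nat.factorial_dvd_factorial hk') (by positivity)]
  simp only [Nat.add_sub_cancel, add_comm 1 k]
  ring

/-- Every vertex is larger than all its ancestors or ends a decreasing path. -/
def DecreasingThenMaxima {n : ℕ} (p : Fin n → Option (Fin n)) : Prop :=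
  ∀ x y z : Fin n, StrictAnc p x y → StrictAnc p y z → (x < z ∧ y < z) ∨ (z < y ∧ y < x)

theorem DecreasingThenMaxima.not_strictAnc_self {n : ℕ} {p : Fin n → Option (Fin n)}
    (h : DecreasingThenMaxima p) (x : Fin n) : ¬ StrictAnc p x x := fun hx => by
  have := h x x x hx hx
  omega

theorem IsForest.not_strictAnc_self {n : ℕ} {p : Fin n → Option (Fin n)}
    (h : IsForest p) (x : Fin n) : ¬ StrictAnc p x x := by
  obtain ⟨d, hd⟩ := h
  have key : ∀ a b, StrictAnc p a b → d a < d b := by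
    intro a b hab
    induction hab with
    | single h => exact hd _ _ h
    | tail _ h ih => exact ih.trans (hd _ _ h)
  exact fun hx => (key x x hx).false

open Classical in
theorem isForest_of_not_strictAnc_self {n : ℕ} {p : Fin n → Option (Fin n)}
    (h : ∀ x, ¬ StrictAnc p x x) : IsForest p := by
  refine ⟨fun v => (Finset.univ.filter fun u => StrictAnc p u v).card, fun v w hvw => ?_⟩
  have hwv : StrictAnc p w v := .single hvw
  refine Finset.card_lt_card (Finset.ssubset_iff_of_subset ?_ |>.2 ⟨w, ?_, ?_⟩)
  · intro u hu
    simp only [Finset.mem_filter, Finset.mem_univ, true_and] at hu ⊢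
    exact hu.trans hwv
  · simpa using hwv
  · simpa using h w

theorem forestContains_of_strictAnc {n : ℕ} {p : Fin n → Option (Fin n)} {a b c : ℕ}
    {x y z : Fin n} (hxy : StrictAnc p x y) (hyz : StrictAnc p y z)
    (h : ∀ i j : Fin 3, ![a, b, c] i < ![a, b, c] j ↔ ![x, y, z] i < ![x, y, z] j) :
    ForestContains p [a, b, c] := by
  refine ⟨![x, y, z], fun i j hij => ?_, fun i j => ?_⟩
  · have hxz := hxy.trans hyz
    change Fin 3 at i j
    fin_cases i <;> fin_cases j <;> first | assumption | exact absurd (Fin.lt_def.1 hij) (by simp)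
  · refine Iff.trans ?_ (h i j)
    change Fin 3 at i j
    fin_cases i <;> fin_cases j <;> rfl

theorem ForestContains.exists_strictAnc {n : ℕ} {p : Fin n → Option (Fin n)} {a b c : ℕ}
    (h : ForestContains p [a, b, c]) :
    ∃ x y z, StrictAnc p x y ∧ StrictAnc p y z ∧
      (a < b ↔ x < y) ∧ (a < c ↔ x < z) ∧ (b < c ↔ y < z) ∧
      (b < a ↔ y < x) ∧ (c < a ↔ z < x) ∧ (c < b ↔ z < y) := by
  obtain ⟨u, hu, hσ⟩ := h
  exact ⟨u ⟨0, by simp⟩, u ⟨1, by simp⟩, u ⟨2, by simp⟩, hu _ _ (Fin.lt_def.2 (by simp)),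
    hu _ _ (Fin.lt_def.2 (by simp)),
    hσ ⟨0, by simp⟩ ⟨1, by simp⟩, hσ ⟨0, by simp⟩ ⟨2, by simp⟩, hσ ⟨1, by simp⟩ ⟨2, by simp⟩,
    hσ ⟨1, by simp⟩ ⟨0, by simp⟩, hσ ⟨2, by simp⟩ ⟨0, by simp⟩, hσ ⟨2, by simp⟩ ⟨1, by simp⟩⟩

theorem isForest_avoids_iff_decreasingThenMaxima {n : ℕ} (p : Fin n → Option (Fin n)) :
    (IsForest p ∧ ForestAvoids p [1, 3, 2] ∧ ForestAvoids p [2, 3, 1] ∧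
      ForestAvoids p [3, 1, 2]) ↔ DecreasingThenMaxima p := by
  constructor
  · rintro ⟨hf, h132, h231, h312⟩ x y z hxy hyz
    have nxy : x ≠ y := by rintro rfl; exact hf.not_strictAnc_self _ hxy
    have nyz : y ≠ z := by rintro rfl; exact hf.not_strictAnc_self _ hyz
    have nxz : x ≠ z := by rintro rfl; exact hf.not_strictAnc_self _ (hxy.trans hyz)
    by_contra hcon
    have hcases : (x < z ∧ z < y) ∨ (z < x ∧ x < y) ∨ (y < z ∧ z < x) := by omega
    rcases hcases with h | h | h
    · refine h132 (forestContains_of_strictAnc hxy hyz fun i j => ?_)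
      fin_cases i <;> fin_cases j <;> simp <;> omega
    · refine h231 (forestContains_of_strictAnc hxy hyz fun i j => ?_)
      fin_cases i <;> fin_cases j <;> simp <;> omega
    · refine h312 (forestContains_of_strictAnc hxy hyz fun i j => ?_)
      fin_cases i <;> fin_cases j <;> simp <;> omega
  · intro h
    refine ⟨isForest_of_not_strictAnc_self h.not_strictAnc_self, ?_, ?_, ?_⟩ <;>
    · intro hc
      obtain ⟨x, y, z, hxy, hyz, h1, h2, h3, h4, h5, h6⟩ := hc.exists_strictAnc
      have := h x y z hxy hyz
      omega

theorem StrictAnc.mono {n : ℕ} {p q : Fin n → Option (Fin n)}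
    (h : ∀ v w, q v = some w → p v = some w) {a b : Fin n} (hab : StrictAnc q a b) :
    StrictAnc p a b :=
  Relation.TransGen.mono (p := fun x y => p y = some x) (fun x y => h y x) _ _ hab

theorem DecreasingThenMaxima.mono {n : ℕ} {p q : Fin n → Option (Fin n)}
    (hp : DecreasingThenMaxima p) (h : ∀ v w, q v = some w → p v = some w) :
    DecreasingThenMaxima q :=
  fun x y z hxy hyz => hp x y z (hxy.mono h) (hyz.mono h)

theorem StrictAnc.exists_parent {n : ℕ} {p : Fin n → Option (Fin n)} {a b : Fin n}
    (h : StrictAnc p a b) : ∃ w, p b = some w ∧ (a = w ∨ StrictAnc p a w) := by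
  cases h with
  | single h => exact ⟨_, h, .inl rfl⟩
  | tail h h' => exact ⟨_, h', .inr h⟩

theorem StrictAnc.exists_child {n : ℕ} {p : Fin n → Option (Fin n)} {a b : Fin n}
    (h : StrictAnc p a b) : ∃ w, p w = some a := by
  induction h using Relation.TransGen.head_induction_on with
  | single h => exact ⟨_, h⟩
  | head h _ _ => exact ⟨_, h⟩

open Finset

/-- All edges of the parent function `p` join vertices of `S`. -/
def SupportedOn {n : ℕ} (S : Finset (Fin n)) (p : Fin n → Option (Fin n)) : Prop :=
  ∀ v w, p v = some w → v ∈ S ∧ w ∈ S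

theorem SupportedOn.mem_of_strictAnc {n : ℕ} {S : Finset (Fin n)} {p : Fin n → Option (Fin n)}
    (hp : SupportedOn S p) {a b : Fin n} (h : StrictAnc p a b) : a ∈ S ∧ b ∈ S := by
  obtain ⟨w, hw, -⟩ := h.exists_parent
  obtain ⟨u, hu⟩ := h.exists_child
  exact ⟨(hp _ _ hu).2, (hp _ _ hw).1⟩

open Classical in
/-- Forests on the label set `S` each of whose root-to-vertex paths decreases and then consists of
successive maxima. -/
noncomputable def forestsOn {n : ℕ} (S : Finset (Fin n)) : Finset (Fin n → Option (Fin n)) :=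
  univ.filter fun p => SupportedOn S p ∧ DecreasingThenMaxima p

theorem mem_forestsOn {n : ℕ} {S : Finset (Fin n)} {p : Fin n → Option (Fin n)} :
    p ∈ forestsOn S ↔ SupportedOn S p ∧ DecreasingThenMaxima p := by
  simp [forestsOn]

/-- Forests on the label set `T` in which every child is smaller than its parent. -/
def decreasingForestsOn {n : ℕ} (T : Finset (Fin n)) : Finset (Fin n → Option (Fin n)) :=
  Fintype.piFinset fun v => if v ∈ T then insertNone (T.filter (v < ·)) else {none}

theorem mem_decreasingForestsOn {n : ℕ} {T : Finset (Fin n)} {p : Fin n → Option (Fin n)} :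
    p ∈ decreasingForestsOn T ↔ ∀ v w, p v = some w → v ∈ T ∧ w ∈ T ∧ v < w := by
  simp only [decreasingForestsOn, Fintype.mem_piFinset]
  refine forall_congr' fun v => ?_
  by_cases hv : v ∈ T
  · simp [hv, mem_insertNone]
  · simp [hv, Option.eq_none_iff_forall_ne_some]

theorem card_decreasingForestsOn {n : ℕ} (T : Finset (Fin n)) :
    (decreasingForestsOn T).card = T.card.factorial := by
  have hprod : (decreasingForestsOn T).card = ∏ v ∈ T, ((T.filter (v < ·)).card + 1) := by
    rw [decreasingForestsOn, Fintype.card_piFinset, ← prod_subset (subset_univ T)]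
    · exact prod_congr rfl fun v hv => by simp [hv]
    · intro v _ hv
      simp [hv]
  rw [hprod]
  clear hprod
  induction T using Finset.induction_on_min with
  | empty => simp
  | insert a T ha ih =>
    have haT : a ∉ T := fun h => (ha a h).false
    rw [prod_insert haT, card_insert_of_notMem haT, Nat.factorial_succ, ← ih, filter_insert,
      if_neg (lt_irrefl a), filter_true_of_mem ha]
    congr 1
    refine prod_congr rfl fun v hv => ?_
    rw [filter_insert, if_neg (ha v hv).not_gt]

theorem strictAnc_update {n : ℕ} {q : Fin n → Option (Fin n)} {m w : Fin n} (hm : ∀ v, q v ≠ some m)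
    (hwm : w ≠ m) {x y : Fin n} (h : StrictAnc (Function.update q m (some w)) x y) :
    x ≠ m ∧ (y ≠ m → StrictAnc q x y) := by
  have hx : x ≠ m := by
    rintro rfl
    obtain ⟨u, hu⟩ := h.exists_child
    rcases eq_or_ne u x with rfl | hux
    · simp_all
    · rw [Function.update_of_ne hux] at hu
      exact hm _ hu
  refine ⟨hx, ?_⟩
  induction h with
  | single h =>
    intro hb
    rw [Function.update_of_ne hb] at h
    exact .single h
  | tail _ h ih =>
    intro hb
    rw [Function.update_of_ne hb] at h
    exact (ih fun hc => hm _ (hc ▸ h)).tail h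

theorem card_forestsOn_insert_max_nonroot {n : ℕ} {R : Finset (Fin n)} {m : Fin n}
    (hm : ∀ v ∈ R, v < m) :
    ((forestsOn (insert m R)).filter fun p => p m ≠ none).card =
      R.card * (forestsOn R).card := by
  have hmR : m ∉ R := fun h => (hm m h).false
  rw [← card_product]
  refine Finset.card_nbij' (fun p => ((p m).getD m, Function.update p m none))
    (fun x => Function.update x.2 m (some x.1)) ?_ ?_ ?_ ?_
  · intro p hp
    simp only [coe_filter, Set.mem_ofPred_eq, mem_forestsOn] at hp
    obtain ⟨⟨hs, hd⟩, hne⟩ := hp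
    obtain ⟨w, hw⟩ := Option.ne_none_iff_exists'.1 hne
    have hwm : w ≠ m := by
      rintro rfl
      exact hd.not_strictAnc_self _ (.single hw)
    have hle : ∀ v ∈ insert m R, v ≤ m := by
      intro v hv
      rcases mem_insert.1 hv with rfl | hv
      · exact le_rfl
      · exact (hm v hv).le
    have hleaf : ∀ v, p v ≠ some m := by
      intro v hv
      have h1 := hd w m v (.single hw) (.single hv)
      have h2 := hle v (hs _ _ hv).1
      have h3 := hle w (hs _ _ hw).2
      omega
    have hwR : w ∈ R := by
      simpa [hwm] using (hs _ _ hw).2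
    have hsub : ∀ v u, Function.update p m none v = some u → v ≠ m ∧ p v = some u := by
      intro v u h
      rcases eq_or_ne v m with rfl | hv
      · simp at h
      · rw [Function.update_of_ne hv] at h
        exact ⟨hv, h⟩
    simp only [hw, Option.getD_some, coe_product, Set.mem_prod, mem_coe, mem_forestsOn]
    refine ⟨hwR, fun v u h => ?_, hd.mono fun v u h => (hsub v u h).2⟩
    obtain ⟨hv, h⟩ := hsub v u h
    have hu : u ≠ m := fun hu => hleaf v (hu ▸ h)
    simpa [hv, hu] using hs _ _ h
  · rintro ⟨w, q⟩ hq
    simp only [coe_product, Set.mem_prod, mem_coe, mem_forestsOn] at hq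
    obtain ⟨hwR, hs, hd⟩ := hq
    have hwm : w ≠ m := by rintro rfl; exact hmR hwR
    simp only [coe_filter, Set.mem_ofPred_eq, mem_forestsOn, Function.update_self]
    have hs' : SupportedOn (insert m R) (Function.update q m (some w)) := by
      intro v u h
      rcases eq_or_ne v m with rfl | hv
      · simp only [Function.update_self, Option.some.injEq] at h
        simp [← h, hwR]
      · rw [Function.update_of_ne hv] at h
        have := hs _ _ h
        simp [this]
    refine ⟨⟨hs', ?_⟩, by simp⟩
    intro x y z hxy hyz
    have hleaf : ∀ v, q v ≠ some m := fun v h => hmR (hs _ _ h).2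
    obtain ⟨hx, hxy'⟩ := strictAnc_update hleaf hwm hxy
    obtain ⟨hy, hyz'⟩ := strictAnc_update hleaf hwm hyz
    rcases eq_or_ne z m with rfl | hz
    · have hxR := (hs'.mem_of_strictAnc hxy).1
      have hyR := (hs'.mem_of_strictAnc hxy).2
      simp only [mem_insert, hx, hy, false_or] at hxR hyR
      exact .inl ⟨hm _ hxR, hm _ hyR⟩
    · exact hd x y z (hxy' hy) (hyz' hz)
  · intro p hp
    simp only [coe_filter, Set.mem_ofPred_eq] at hp
    obtain ⟨w, hw⟩ := Option.ne_none_iff_exists'.1 hp.2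
    simp only [hw, Option.getD_some, Function.update_idem]
    rw [← hw, Function.update_eq_self]
  · rintro ⟨w, q⟩ hq
    simp only [coe_product, Set.mem_prod, mem_coe, mem_forestsOn] at hq
    have hqm : q m = none := by
      rw [Option.eq_none_iff_forall_ne_some]
      exact fun u h => hmR (hq.2.1 _ _ h).1
    simp [← hqm]

open Classical in
/-- The strict descendants of `m` in the forest `p`. -/
noncomputable def descendants {n : ℕ} (p : Fin n → Option (Fin n)) (m : Fin n) : Finset (Fin n) :=
  univ.filter fun v => StrictAnc p m v

theorem mem_descendants {n : ℕ} {p : Fin n → Option (Fin n)} {m v : Fin n} :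
    v ∈ descendants p m ↔ StrictAnc p m v := by
  simp [descendants]

/-- Hang the forest `r` on `T` below the vertex `m`, keeping `q` elsewhere. -/
def graft {n : ℕ} (m : Fin n) (T : Finset (Fin n)) (r q : Fin n → Option (Fin n)) :
    Fin n → Option (Fin n) :=
  fun v => if v ∈ T then some ((r v).getD m) else q v

section graft

variable {n : ℕ} {m : Fin n} {R T : Finset (Fin n)} {r q : Fin n → Option (Fin n)}

theorem graft_eq_some (hm : ∀ v ∈ R, v < m) (hT : T ⊆ R) (hr : r ∈ decreasingForestsOn T)
    (hq : SupportedOn (R \ T) q) {v w : Fin n} (h : graft m T r q v = some w) :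
    (v ∈ T ∧ (w = m ∨ w ∈ T) ∧ v < w) ∨ (v ∈ R \ T ∧ w ∈ R \ T ∧ q v = some w) := by
  rw [mem_decreasingForestsOn] at hr
  by_cases hv : v ∈ T
  · simp only [graft, hv, if_true, Option.some.injEq] at h
    refine .inl ⟨hv, ?_⟩
    cases hrv : r v with
    | none =>
      rw [hrv, Option.getD_none] at h
      exact ⟨.inl h.symm, h ▸ hm v (hT hv)⟩
    | some u =>
      rw [hrv, Option.getD_some] at h
      subst h
      exact ⟨.inr (hr _ _ hrv).2.1, (hr _ _ hrv).2.2⟩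
  · simp only [graft, hv, if_false] at h
    exact .inr ⟨(hq _ _ h).1, (hq _ _ h).2, h⟩

theorem strictAnc_graft (hm : ∀ v ∈ R, v < m) (hT : T ⊆ R) (hr : r ∈ decreasingForestsOn T)
    (hq : SupportedOn (R \ T) q) {x y : Fin n} (h : StrictAnc (graft m T r q) x y) :
    (y ∈ T ∧ (x = m ∨ x ∈ T) ∧ y < x) ∨ (x ∈ R \ T ∧ y ∈ R \ T ∧ StrictAnc q x y) := by
  induction h with
  | single h =>
    rcases graft_eq_some hm hT hr hq h with h | ⟨h1, h2, h3⟩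
    · exact .inl h
    · exact .inr ⟨h2, h1, .single h3⟩
  | tail _ h ih =>
    rcases graft_eq_some hm hT hr hq h with ⟨h1, h2, h3⟩ | ⟨h1, h2, h3⟩
    · rcases ih with ⟨i1, i2, i3⟩ | ⟨i1, i2, i3⟩
      · exact .inl ⟨h1, i2, h3.trans i3⟩
      · rcases h2 with rfl | h2
        · exact absurd (hm _ (mem_sdiff.1 i2).1) (lt_irrefl _)
        · exact absurd h2 (mem_sdiff.1 i2).2
    · rcases ih with ⟨i1, i2, i3⟩ | ⟨i1, i2, i3⟩
      · exact absurd i1 (mem_sdiff.1 h2).2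
      · exact .inr ⟨i1, h1, i3.tail h3⟩

theorem descendants_graft (hm : ∀ v ∈ R, v < m) (hT : T ⊆ R) (hr : r ∈ decreasingForestsOn T)
    (hq : SupportedOn (R \ T) q) : descendants (graft m T r q) m = T := by
  ext v
  rw [mem_descendants]
  constructor
  · intro h
    rcases strictAnc_graft hm hT hr hq h with ⟨h1, -⟩ | ⟨h1, -⟩
    · exact h1
    · exact absurd (hm _ (mem_sdiff.1 h1).1) (lt_irrefl _)
  · induction v using WellFoundedGT.induction with
    | ind v ih =>
      intro hv
      have hpar : graft m T r q v = some ((r v).getD m) := by simp [graft, hv]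
      rcases graft_eq_some hm hT hr hq hpar with ⟨-, h1, h2⟩ | ⟨h1, -⟩
      · rcases h1 with h1 | h1
        · rw [h1] at hpar
          exact .single hpar
        · exact (ih _ h2 h1).tail hpar
      · exact absurd hv (mem_sdiff.1 h1).2

theorem graft_mem_forestsOn (hm : ∀ v ∈ R, v < m) (hT : T ⊆ R) (hr : r ∈ decreasingForestsOn T)
    (hq : q ∈ forestsOn (R \ T)) : graft m T r q ∈ forestsOn (insert m R) := by
  rw [mem_forestsOn] at hq ⊢
  obtain ⟨hs, hd⟩ := hq
  constructor
  · intro v w h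
    rcases graft_eq_some hm hT hr hs h with ⟨h1, rfl | h2, -⟩ | ⟨h1, h2, -⟩
    · simp [hT h1]
    · simp [hT h1, hT h2]
    · simp [(mem_sdiff.1 h1).1, (mem_sdiff.1 h2).1]
  · intro x y z hxy hyz
    rcases strictAnc_graft hm hT hr hs hxy with ⟨i1, i2, i3⟩ | ⟨i1, i2, i3⟩ <;>
    rcases strictAnc_graft hm hT hr hs hyz with ⟨j1, j2, j3⟩ | ⟨j1, j2, j3⟩
    · exact .inr ⟨j3, i3⟩
    · exact absurd i1 (mem_sdiff.1 j1).2
    · rcases j2 with rfl | j2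
      · exact absurd (hm _ (mem_sdiff.1 i2).1) (lt_irrefl _)
      · exact absurd j2 (mem_sdiff.1 i2).2
    · exact hd x y z i3 j3

end graft

theorem card_forestsOn_insert_max_root {n : ℕ} {R T : Finset (Fin n)} {m : Fin n}
    (hm : ∀ v ∈ R, v < m) (hT : T ⊆ R) :
    (((forestsOn (insert m R)).filter fun p => p m = none).filter
      fun p => descendants p m = T).card = T.card.factorial * (forestsOn (R \ T)).card := by
  have hmR : m ∉ R := fun h => (hm m h).false
  rw [← card_decreasingForestsOn, ← card_product]
  refine Finset.card_nbij'
    (fun p => (fun v => if v ∈ T ∧ p v ≠ some m then p v else none,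
      fun v => if v ∈ T then none else p v))
    (fun x => graft m T x.1 x.2) ?_ ?_ ?_ ?_
  · intro p hp
    simp only [coe_filter, mem_filter, Set.mem_ofPred_eq, mem_forestsOn] at hp
    obtain ⟨⟨⟨hs, hd⟩, hpm⟩, hdesc⟩ := hp
    have hmem : ∀ v, v ∈ T ↔ StrictAnc p m v := fun v => by rw [← hdesc, mem_descendants]
    simp only [coe_product, Set.mem_prod, mem_coe, mem_forestsOn, mem_decreasingForestsOn]
    refine ⟨fun v w h => ?_, fun v w h => ?_, hd.mono fun v w h => ?_⟩
    · split_ifs at h with hv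
      have hwm : w ≠ m := by rintro rfl; exact hv.2 h
      obtain ⟨w', hw', hmw⟩ := ((hmem v).1 hv.1).exists_parent
      obtain rfl : w = w' := by simpa [h] using hw'
      have hmw : StrictAnc p m w := hmw.resolve_left hwm.symm
      refine ⟨hv.1, (hmem w).2 hmw, ?_⟩
      have h1 := hd m w v hmw (.single h)
      have h2 := hm v (hT hv.1)
      omega
    · dsimp only at h
      split_ifs at h with hv
      have hvm : v ≠ m := by rintro rfl; simp [hpm] at h
      have hwm : w ≠ m := by rintro rfl; exact hv ((hmem v).2 (.single h))
      have hwT : w ∉ T := fun hw => hv ((hmem v).2 (((hmem w).1 hw).tail h))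
      have := hs _ _ h
      simp_all
    · split_ifs at h
      exact h
  · rintro ⟨r, q⟩ hrq
    simp only [coe_product, Set.mem_prod, mem_coe] at hrq
    simp only [coe_filter, mem_filter, Set.mem_ofPred_eq]
    have hs := (mem_forestsOn.1 hrq.2).1
    refine ⟨⟨graft_mem_forestsOn hm hT hrq.1 hrq.2, ?_⟩, descendants_graft hm hT hrq.1 hs⟩
    have hmT : m ∉ T := fun h => hmR (hT h)
    simp only [graft, hmT, if_false, Option.eq_none_iff_forall_ne_some]
    exact fun u h => hmR (mem_sdiff.1 (hs _ _ h).1).1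
  · intro p hp
    simp only [coe_filter, mem_filter, Set.mem_ofPred_eq] at hp
    funext v
    by_cases hv : v ∈ T
    · obtain ⟨w, hw, -⟩ := (mem_descendants.1 (hp.2.symm ▸ hv)).exists_parent
      by_cases hwm : w = m <;> simp [graft, hv, hw, hwm]
    · simp [graft, hv]
  · rintro ⟨r, q⟩ hrq
    simp only [coe_product, Set.mem_prod, mem_coe, mem_decreasingForestsOn, mem_forestsOn] at hrq
    obtain ⟨hr, hs, -⟩ := hrq
    refine Prod.ext (funext fun v => ?_) (funext fun v => ?_)
    · by_cases hv : v ∈ T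
      · cases hrv : r v with
        | none => simp [graft, hv, hrv]
        | some u =>
          have hum : u ≠ m := by
            rintro rfl
            exact hmR (hT (hr _ _ hrv).2.1)
          simp [graft, hv, hrv, hum]
      · have : r v = none := by
          rw [Option.eq_none_iff_forall_ne_some]
          exact fun u h => hv (hr _ _ h).1
        simp [hv, this]
    · by_cases hv : v ∈ T
      · have : q v = none := by
          rw [Option.eq_none_iff_forall_ne_some]
          exact fun u h => (mem_sdiff.1 (hs _ _ h).1).2 hv
        simp [hv, this]
      · simp [graft, hv]

theorem card_forestsOn_insert_max {n : ℕ} {R : Finset (Fin n)} {m : Fin n}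
    (hm : ∀ v ∈ R, v < m) :
    (forestsOn (insert m R)).card = R.card * (forestsOn R).card +
      ∑ T ∈ R.powerset, T.card.factorial * (forestsOn (R \ T)).card := by
  rw [← card_filter_add_card_filter_not (fun p : Fin n → Option (Fin n) => p m ≠ none),
    card_forestsOn_insert_max_nonroot hm]
  simp only [not_not]
  congr 1
  rw [card_eq_sum_card_fiberwise (f := fun p => descendants p m) (t := R.powerset)]
  · exact sum_congr rfl fun T hT => card_forestsOn_insert_max_root hm (mem_powerset.1 hT)
  · intro p hp
    simp only [coe_filter, Set.mem_ofPred_eq, mem_forestsOn] at hp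
    simp only [coe_powerset, Set.mem_preimage, Set.mem_powerset_iff, coe_subset]
    intro v hv
    rw [mem_descendants] at hv
    have hvm : v ≠ m := by
      rintro rfl
      exact hp.1.2.not_strictAnc_self _ hv
    simpa [hvm] using (hp.1.1.mem_of_strictAnc hv).2

theorem card_forestsOn {n : ℕ} (S : Finset (Fin n)) :
    ((forestsOn S).card : ℚ) = S.card.factorial * lahRatio S.card := by
  induction S using Finset.strongInduction with
  | H S ih =>
    rcases S.eq_empty_or_nonempty with rfl | hS
    · have : forestsOn (∅ : Finset (Fin n)) = {fun _ => none} := by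
        ext p
        rw [mem_forestsOn, mem_singleton]
        constructor
        · rintro ⟨h, -⟩
          funext v
          rw [Option.eq_none_iff_forall_ne_some]
          exact fun u hu => by simpa using h _ _ hu
        · rintro rfl
          have hs : SupportedOn (∅ : Finset (Fin n)) fun _ => none := by simp [SupportedOn]
          exact ⟨hs, fun x y z h _ => by simpa using hs.mem_of_strictAnc h⟩
      simp [this, lahRatio]
    · set m := S.max' hS
      set R := S.erase m
      have hmS : m ∈ S := S.max'_mem hS
      have hm : ∀ v ∈ R, v < m := fun v hv => S.lt_max'_of_mem_erase_max' hS hv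
      have hSR : S = insert m R := (insert_erase hmS).symm
      have hlt : ∀ T ⊆ R, T ⊂ S := fun T hT => hT.trans_ssubset (erase_ssubset hmS)
      have hcard : S.card = R.card + 1 := (card_erase_add_one hmS).symm
      have hsum : ∑ T ∈ R.powerset, (T.card.factorial * (forestsOn (R \ T)).card : ℚ) =
          R.card.factorial * ∑ j ∈ range (R.card + 1), lahRatio j := by
        have h1 : ∀ T ∈ R.powerset, (T.card.factorial * (forestsOn (R \ T)).card : ℚ) =
            (fun k => (k.factorial * ((R.card - k).factorial * lahRatio (R.card - k)) : ℚ))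
              T.card := by
          intro T hT
          rw [mem_powerset] at hT
          rw [ih _ (hlt _ sdiff_subset), card_sdiff_of_subset hT]
        rw [sum_congr rfl h1,
          sum_powerset_apply_card (fun k =>
            (k.factorial * ((R.card - k).factorial * lahRatio (R.card - k)) : ℚ)), mul_sum, ← sum_range_reflect]
        simp only [nsmul_eq_mul]
        refine sum_congr rfl fun k hk => ?_
        have hk' : k ≤ R.card := by have := mem_range.1 hk; omega
        have e1 : R.card + 1 - 1 - k = R.card - k := by omega
        have e2 : R.card - (R.card - k) = k := by omega
        rw [e1, e2, ← Nat.choose_mul_factorial_mul_factorial (Nat.sub_le R.card k), e2]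
        push_cast
        ring
      rw [hcard, Nat.factorial_succ, hSR, card_forestsOn_insert_max hm]
      push_cast
      rw [hsum, ih R (hlt R Subset.rfl)]
      have := lahRatio_recurrence R.card
      linear_combination (-(R.card.factorial : ℚ)) * this

theorem count_forests_avoiding_132_231_312 (n : ℕ) (hn : 1 ≤ n) :
    Nat.card {p : Fin n → Option (Fin n) //
        IsForest p ∧ ForestAvoids p [1, 3, 2] ∧ ForestAvoids p [2, 3, 1] ∧
        ForestAvoids p [3, 1, 2]} =
    ∑ k ∈ Finset.Icc 1 n, (n.factorial / k.factorial) * (n - 1).choose (k - 1) := by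
  have hcard : Nat.card {p : Fin n → Option (Fin n) //
      IsForest p ∧ ForestAvoids p [1, 3, 2] ∧ ForestAvoids p [2, 3, 1] ∧
      ForestAvoids p [3, 1, 2]} = (forestsOn (univ : Finset (Fin n))).card := by
    refine Nat.subtype_card _ fun p => ?_
    rw [isForest_avoids_iff_decreasingThenMaxima, mem_forestsOn]
    simp [SupportedOn]
  rw [hcard]
  have h := card_forestsOn (univ : Finset (Fin n))
  rw [card_univ, Fintype.card_fin, ← cast_sum_eq_factorial_mul_lahRatio n hn] at h
  exact_mod_cast h
end
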